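/- Suppose 𝒜 has rank 2 and the linear order on 𝒜 is admissible: there exists an integer ν such that H_i and H_1 are parallel (i.e. H_i ∩ H_1 = ∅, or i = 1) if and only if 1 ≤ i < ν. Then βnbc(𝒜) = {(H_{i_1}, H_{i_2}) ∈ nbc(𝒜) : 1 < i_1 < i_2 and i_2 ≠ ν}. -/

import Mathlib

open Module

noncomputable section

/-- An arrangement of `n` (affine) hyperplanes inside the ambient affine subspace `amb`
of the complex vector space `W`.  The linear order on the hyperplanes is the order of the
indices in `Fin n`; an arbitrary linear order is encoded by a permutation `σ` of `Fin n`,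
with `i ≺ j ↔ σ i < σ j`. -/
structure HArr (W : Type) [AddCommGroup W] [Module ℂ W] (n : ℕ) where
  amb : AffineSubspace ℂ W
  amb_ne : (amb : Set W).Nonempty
  H : Fin n → AffineSubspace ℂ W
  inj : Function.Injective H
  le_amb : ∀ i, H i ≤ amb
  nonemptyH : ∀ i, ((H i : Set W)).Nonempty
  hyp : ∀ i, finrank ℂ (H i).direction + 1 = finrank ℂ amb.direction

namespace HArr

variable {W : Type} [AddCommGroup W] [Module ℂ W] {n : ℕ}

/-- The intersection `⋂ S` of a subset of the arrangement (the ambient space for `S = ∅`). -/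
def inter (A : HArr W n) (S : Finset (Fin n)) : AffineSubspace ℂ W :=
  A.amb ⊓ S.inf A.H

/-- Codimension (inside the ambient space) of an affine subspace. -/
def cd (A : HArr W n) (X : AffineSubspace ℂ W) : ℕ :=
  finrank ℂ A.amb.direction - finrank ℂ X.direction

/-- A dependent subset of the arrangement. -/
def dep (A : HArr W n) (S : Finset (Fin n)) : Prop :=
  A.inter S ≠ ⊥ ∧ A.cd (A.inter S) < S.card

/-- An independent subset of the arrangement. -/
def indep (A : HArr W n) (S : Finset (Fin n)) : Prop :=
  A.inter S ≠ ⊥ ∧ A.cd (A.inter S) = S.card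

/-- A base: a maximal independent subset. -/
def isBase (A : HArr W n) (S : Finset (Fin n)) : Prop :=
  A.indep S ∧ ∀ T, A.indep T → S ⊆ T → S = T

open scoped Classical in
/-- The rank of a subarrangement `{H i : i ∈ C}`. -/
def rankOn (A : HArr W n) (C : Finset (Fin n)) : ℕ :=
  C.powerset.sup fun S => if A.indep S then S.card else 0

/-- The rank `r` of the arrangement. -/
def rank (A : HArr W n) : ℕ := A.rankOn Finset.univ

/-- A circuit: an inclusion-minimal dependent set. -/
def circuit (A : HArr W n) (S : Finset (Fin n)) : Prop :=
  A.dep S ∧ ∀ T ⊂ S, ¬ A.dep T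

/-- A broken circuit w.r.t. the linear order given by `σ`. -/
def brokenCircuit (A : HArr W n) (σ : Equiv.Perm (Fin n)) (S : Finset (Fin n)) : Prop :=
  ∃ i ∉ S, (∀ j ∈ S, σ i < σ j) ∧ A.circuit (insert i S)

/-- An nbc set: nonempty intersection and containing no broken circuit. -/
def nbcSet (A : HArr W n) (σ : Equiv.Perm (Fin n)) (S : Finset (Fin n)) : Prop :=
  A.inter S ≠ ⊥ ∧ ∀ T ⊆ S, ¬ A.brokenCircuit σ T

/-- An nbc-base. -/
def nbcBase (A : HArr W n) (σ : Equiv.Perm (Fin n)) (S : Finset (Fin n)) : Prop :=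
  A.nbcSet σ S ∧ A.isBase S

/-- A βnbc-base. -/
def betaNbcBase (A : HArr W n) (σ : Equiv.Perm (Fin n)) (S : Finset (Fin n)) : Prop :=
  A.nbcBase σ S ∧ ∀ i ∈ S, ∃ j, σ j < σ i ∧ A.isBase (insert j (S.erase i))

/-- Membership in the intersection poset `L(𝒜)`. -/
def memL (A : HArr W n) (X : AffineSubspace ℂ W) : Prop :=
  X ≠ ⊥ ∧ ∃ S : Finset (Fin n), A.inter S = X

/-- A maximal element of `L(𝒜)` (in the reverse-inclusion order). -/
def maximalL (A : HArr W n) (X : AffineSubspace ℂ W) : Prop :=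
  A.memL X ∧ ∀ Y, A.memL Y → Y ≤ X → Y = X

open scoped Classical in
/-- The set of indices of hyperplanes containing `X`, i.e. `𝒜_X`. -/
def sub (A : HArr W n) (X : AffineSubspace ℂ W) : Finset (Fin n) :=
  Finset.univ.filter fun i => X ≤ A.H i

/-- `X` is dense: `𝒜_X` admits no decomposition into two nonempty parts. -/
def denseL (A : HArr W n) (X : AffineSubspace ℂ W) : Prop :=
  ¬ ∃ S T : Finset (Fin n), Disjoint S T ∧ S.Nonempty ∧ T.Nonempty ∧
      S ∪ T = A.sub X ∧ A.cd (A.inter S) + A.cd (A.inter T) = A.cd X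

/-- `i` is the minimum of `S` w.r.t. the linear order given by `σ`. -/
def isMin (σ : Equiv.Perm (Fin n)) (i : Fin n) (S : Finset (Fin n)) : Prop :=
  i ∈ S ∧ ∀ j ∈ S, σ i ≤ σ j

/-- The standard ordered tuple of a finite set, w.r.t. the linear order given by `σ`:
`tup σ S p` is the element of `S` with `(p+1)`-st smallest `σ`-value. -/
def tup (σ : Equiv.Perm (Fin n)) (S : Finset (Fin n)) (p : Fin S.card) : Fin n :=
  σ.symm (((S.image ⇑σ).orderIsoOfFin (Finset.card_image_of_injective S σ.injective) p).1)

/-- The flag `ξ(B) = (X_1 > ⋯ > X_r)` of a standard ordered base: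
`flag σ S p = X_{p+1} = ⋂_{k ≥ p} H_{i_k}`. -/
def flag (A : HArr W n) (σ : Equiv.Perm (Fin n)) (S : Finset (Fin n)) (p : Fin S.card) :
    AffineSubspace ℂ W :=
  A.inter (S.filter fun i => σ (tup σ S p) ≤ σ i)

/-- Lexicographic order on standard ordered tuples (for the canonical order). -/
def lexLt (S T : Finset (Fin n)) : Prop :=
  List.Lex (· < ·) (S.sort (· ≤ ·)) (T.sort (· ≤ ·))

/-- `λ(X) = Σ_{H_i ∈ 𝒜_X} λ_i`. -/
def lamX (A : HArr W n) (lam : Fin n → ℂ) (X : AffineSubspace ℂ W) : ℂ :=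
  ∑ i ∈ A.sub X, lam i

/-- `X` is unmixed (w.r.t. the order `σ`). -/
def unmixedX (A : HArr W n) (σ : Equiv.Perm (Fin n)) (X : AffineSubspace ℂ W) : Prop :=
  (∀ S, A.nbcBase σ S → A.inter S = X → A.betaNbcBase σ S) ∨
  (∀ S, A.nbcBase σ S → A.inter S = X → ¬ A.betaNbcBase σ S)

/-- The linear order given by `σ` is unmixed. -/
def unmixedOrd (A : HArr W n) (σ : Equiv.Perm (Fin n)) : Prop :=
  ∀ X, A.maximalL X → A.unmixedX σ X

/-- Membership in the intersection poset of the deleted arrangement `𝒜 ∖ {H_{i₀}}`. -/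
def memLdel (A : HArr W n) (i₀ : Fin n) (X : AffineSubspace ℂ W) : Prop :=
  X ≠ ⊥ ∧ ∃ S : Finset (Fin n), i₀ ∉ S ∧ A.inter S = X

/-- A maximal element of the intersection poset of the deleted arrangement. -/
def maximalLdel (A : HArr W n) (i₀ : Fin n) (X : AffineSubspace ℂ W) : Prop :=
  A.memLdel i₀ X ∧ ∀ Y, A.memLdel i₀ Y → Y ≤ X → Y = X

/-- The generator `e_i` of the exterior algebra `E`. -/
def gen (i : Fin n) : ExteriorAlgebra ℂ (Fin n → ℂ) :=
  ExteriorAlgebra.ι ℂ (Pi.single i 1)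

/-- `e_S = e_{i_1} ∧ ⋯ ∧ e_{i_p}` for `S = {i_1 < ⋯ < i_p}`. -/
def eS (S : Finset (Fin n)) : ExteriorAlgebra ℂ (Fin n → ℂ) :=
  ((S.sort (· ≤ ·)).map gen).prod

/-- `∂e_S = Σ_k (−1)^{k−1} e_{S ∖ {i_k}}`. -/
def bdry (S : Finset (Fin n)) : ExteriorAlgebra ℂ (Fin n → ℂ) :=
  ∑ i ∈ S, ((-1 : ℂ) ^ (S.filter fun j => j < i).card) • eS (S.erase i)

/-- The defining relations of the Orlik–Solomon algebra. -/
inductive OSRel (A : HArr W n) :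
    ExteriorAlgebra ℂ (Fin n → ℂ) → ExteriorAlgebra ℂ (Fin n → ℂ) → Prop
  | isBot : ∀ S : Finset (Fin n), A.inter S = ⊥ → OSRel A (eS S) 0
  | isDep : ∀ S : Finset (Fin n), A.dep S → OSRel A (bdry S) 0

/-- The Orlik–Solomon algebra `A(𝒜)`: the exterior algebra modulo the ideal generated by
the `e_S` with empty intersection and the `∂e_S` with `S` dependent. -/
abbrev OS (A : HArr W n) := RingQuot (OSRel A)

/-- The quotient map `E → A(𝒜)`. -/
def osMk (A : HArr W n) : ExteriorAlgebra ℂ (Fin n → ℂ) →ₐ[ℂ] OS A :=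
  RingQuot.mkAlgHom ℂ (OSRel A)

/-- `ω_i`, the image of `e_i` in the Orlik–Solomon algebra. -/
def om (A : HArr W n) (i : Fin n) : OS A := osMk A (gen i)

/-- `ω_B`, the image of `e_B` in the Orlik–Solomon algebra. -/
def omB (A : HArr W n) (S : Finset (Fin n)) : OS A := osMk A (eS S)

/-- The degree `p` part `A^p` of the Orlik–Solomon algebra. -/
def deg (A : HArr W n) (p : ℕ) : Submodule ℂ (OS A) :=
  Submodule.span ℂ {x | ∃ S : Finset (Fin n), S.card = p ∧ x = omB A S}

/-- `ω_λ = Σ_i λ_i ω_i`. -/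
def omLam (A : HArr W n) (lam : Fin n → ℂ) : OS A := ∑ i, lam i • om A i

/-- `ω_λ(X) = Σ_{H_i ∈ 𝒜_X} λ_i ω_i`. -/
def omLamX (A : HArr W n) (lam : Fin n → ℂ) (X : AffineSubspace ℂ W) : OS A :=
  ∑ i ∈ A.sub X, lam i • om A i

/-- The form `Ξ(B) = ω_λ(X_1) ⋯ ω_λ(X_r)` attached to a standard ordered base. -/
def Xi (A : HArr W n) (σ : Equiv.Perm (Fin n)) (lam : Fin n → ℂ) (S : Finset (Fin n)) :
    OS A :=
  ((List.finRange S.card).map fun p => A.omLamX lam (A.flag σ S p)).prod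

/-- The submodule `ω_λ ∧ A^p` of the Orlik-Solomon algebra. -/
def Ideg (A : HArr W n) (lam : Fin n → ℂ) (p : ℕ) : Submodule ℂ (OS A) :=
  (A.deg p).map (LinearMap.mulLeft ℂ (A.omLam lam))

end HArr

namespace HArr

variable {W : Type} [AddCommGroup W] [Module ℂ W] {n : ℕ}

theorem inter_singleton (A : HArr W n) (a : Fin n) : A.inter {a} = A.H a := by
  simp [inter, A.le_amb a]

theorem inter_pair (A : HArr W n) (a b : Fin n) : A.inter {a, b} = A.H a ⊓ A.H b := by
  simp only [inter, Finset.inf_insert, Finset.inf_singleton]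
  exact inf_eq_right.mpr (inf_le_left.trans (A.le_amb a))

theorem H_ne_bot (A : HArr W n) (a : Fin n) : A.H a ≠ ⊥ :=
  (AffineSubspace.nonempty_iff_ne_bot _).mp (A.nonemptyH a)

theorem indep_singleton (A : HArr W n) (a : Fin n) : A.indep {a} := by
  refine ⟨by rw [inter_singleton]; exact A.H_ne_bot a, ?_⟩
  rw [inter_singleton, cd, ← A.hyp a]
  simp

theorem eq_of_direction_eq (A : HArr W n) {a b : Fin n} (h : A.H a ⊓ A.H b ≠ ⊥)
    (hd : (A.H a).direction = (A.H b).direction) : a = b :=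
  A.inj (AffineSubspace.ext_of_direction_eq hd
    ((AffineSubspace.nonempty_iff_ne_bot _).mpr h))

theorem card_le_rank (A : HArr W n) {S : Finset (Fin n)} (h : A.indep S) :
    S.card ≤ A.rank := by
  classical
  have := Finset.le_sup (f := fun S => if A.indep S then S.card else 0)
    (Finset.mem_powerset.mpr (Finset.subset_univ S))
  simp only [h, if_true] at this
  unfold rank rankOn
  convert this

theorem exists_indep_card_eq_rank (A : HArr W n) (h : A.rank ≠ 0) :
    ∃ S, A.indep S ∧ S.card = A.rank := by
  classical
  obtain ⟨S, -, hS⟩ := Finset.exists_mem_eq_sup (Finset.univ : Finset (Fin n)).powerset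
    (Finset.powerset_nonempty _) (fun S => if A.indep S then S.card else 0)
  have hr : A.rank = if A.indep S then S.card else 0 := by
    rw [← hS]
    unfold rank rankOn
    congr!
  split_ifs at hr with hi
  · exact ⟨S, hi, hr.symm⟩
  · exact absurd hr h

variable [FiniteDimensional ℂ W]

theorem sup_direction_eq (A : HArr W n) {a b : Fin n}
    (hd : (A.H a).direction ≠ (A.H b).direction) :
    (A.H a).direction ⊔ (A.H b).direction = A.amb.direction := by
  have hle := sup_le (AffineSubspace.direction_le (A.le_amb a))
    (AffineSubspace.direction_le (A.le_amb b))
  refine Submodule.eq_of_le_of_finrank_le hle ?_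
  have ha := A.hyp a
  have hb := A.hyp b
  have hlt : (A.H a).direction < (A.H a).direction ⊔ (A.H b).direction := by
    refine lt_of_le_of_ne le_sup_left fun he => hd ?_
    have hba : (A.H b).direction ≤ (A.H a).direction := he ▸ le_sup_right
    exact (Submodule.eq_of_le_of_finrank_eq hba (by omega)).symm
  have := Submodule.finrank_lt_finrank_of_lt hlt
  omega

theorem inf_ne_bot_of_direction_ne (A : HArr W n) {a b : Fin n}
    (hd : (A.H a).direction ≠ (A.H b).direction) : A.H a ⊓ A.H b ≠ ⊥ := by
  obtain ⟨p, hp⟩ := A.nonemptyH a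
  obtain ⟨q, hq⟩ := A.nonemptyH b
  have hpq : q -ᵥ p ∈ (A.H a).direction ⊔ (A.H b).direction := by
    rw [A.sup_direction_eq hd]
    exact AffineSubspace.vsub_mem_direction (A.le_amb b hq) (A.le_amb a hp)
  obtain ⟨u, hu, v, hv, huv⟩ := Submodule.mem_sup.mp hpq
  refine (AffineSubspace.nonempty_iff_ne_bot _).mp ⟨u +ᵥ p, ?_, ?_⟩
  · exact AffineSubspace.vadd_mem_of_mem_direction hu hp
  · have : u +ᵥ p = -v +ᵥ q := by
      simp only [vsub_eq_sub, vadd_eq_add] at *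
      rw [eq_sub_iff_add_eq] at huv
      rw [← huv]
      abel
    rw [this]
    exact AffineSubspace.vadd_mem_of_mem_direction (neg_mem hv) hq

/-- Distinct hyperplanes meet exactly when their directions differ. -/
theorem ne_and_inf_ne_bot_iff (A : HArr W n) {a b : Fin n} :
    (a ≠ b ∧ A.H a ⊓ A.H b ≠ ⊥) ↔ (A.H a).direction ≠ (A.H b).direction :=
  ⟨fun h hd => h.1 (A.eq_of_direction_eq h.2 hd), fun hd =>
    ⟨fun h => hd (h ▸ rfl), A.inf_ne_bot_of_direction_ne hd⟩⟩

theorem indep_pair (A : HArr W n) {a b : Fin n}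
    (hd : (A.H a).direction ≠ (A.H b).direction) : A.indep {a, b} := by
  obtain ⟨hab, hne⟩ := A.ne_and_inf_ne_bot_iff.mpr hd
  refine ⟨by rwa [inter_pair], ?_⟩
  obtain ⟨p, hp⟩ := (AffineSubspace.nonempty_iff_ne_bot _).mpr hne
  rw [inter_pair, cd, AffineSubspace.direction_inf_of_mem hp.1 hp.2, Finset.card_pair hab]
  have h := Submodule.finrank_sup_add_finrank_inf_eq (A.H a).direction (A.H b).direction
  rw [A.sup_direction_eq hd] at h
  have ha := A.hyp a
  have hb := A.hyp b
  omega

theorem direction_ne_of_indep_pair (A : HArr W n) {a b : Fin n} (hab : a ≠ b)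
    (h : A.indep {a, b}) : (A.H a).direction ≠ (A.H b).direction :=
  A.ne_and_inf_ne_bot_iff.mp ⟨hab, A.inter_pair a b ▸ h.1⟩

theorem isBase_pair (A : HArr W n) (hr : A.rank = 2) {a b : Fin n}
    (hd : (A.H a).direction ≠ (A.H b).direction) : A.isBase {a, b} := by
  refine ⟨A.indep_pair hd, fun T hT hsub => Finset.eq_of_subset_of_card_le hsub ?_⟩
  rw [Finset.card_pair (A.ne_and_inf_ne_bot_iff.mpr hd).1, ← hr]
  exact A.card_le_rank hT

theorem card_eq_two_of_isBase (A : HArr W n) (hr : A.rank = 2) {S : Finset (Fin n)}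
    (h : A.isBase S) : S.card = 2 := by
  obtain ⟨R, hR, hRc⟩ := A.exists_indep_card_eq_rank (by omega)
  obtain ⟨x, y, hxy, rfl⟩ := Finset.card_eq_two.mp (hRc.trans hr)
  have hd := A.direction_ne_of_indep_pair hxy hR
  have hle := hr ▸ A.card_le_rank h.1
  have h0 : S.card ≠ 0 := fun h0 => by
    obtain rfl := Finset.card_eq_zero.mp h0
    exact (Finset.singleton_ne_empty x) (h.2 _ (A.indep_singleton x) (Finset.empty_subset _)).symm
  have h1 : S.card ≠ 1 := fun h1 => by
    obtain ⟨i, rfl⟩ := Finset.card_eq_one.mp h1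
    have key : ∀ z, (A.H i).direction = (A.H z).direction := fun z => by
      by_contra hz
      have := h.2 _ (A.indep_pair hz) (by simp)
      have hc := congrArg Finset.card this
      rw [Finset.card_pair (A.ne_and_inf_ne_bot_iff.mpr hz).1] at hc
      simp at hc
    exact hd ((key x).symm.trans (key y))
  omega

/-- In rank two, the bases are the pairs of non-parallel hyperplanes. -/
theorem isBase_pair_iff (A : HArr W n) (hr : A.rank = 2) {a b : Fin n} :
    A.isBase {a, b} ↔ (A.H a).direction ≠ (A.H b).direction := by
  refine ⟨fun h => A.direction_ne_of_indep_pair ?_ h.1, A.isBase_pair hr⟩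
  rintro rfl
  simpa using A.card_eq_two_of_isBase hr h

theorem exists_lt_of_isBase (A : HArr W n) (hr : A.rank = 2) {S : Finset (Fin n)}
    (h : A.isBase S) : ∃ a b, a < b ∧ S = {a, b} := by
  obtain ⟨a, b, hab, rfl⟩ := Finset.card_eq_two.mp (A.card_eq_two_of_isBase hr h)
  rcases hab.lt_or_gt with hlt | hlt
  · exact ⟨a, b, hlt, rfl⟩
  · exact ⟨b, a, hlt, Finset.pair_comm a b⟩

theorem betaNbcBase_pair_iff (A : HArr W n) (hr : A.rank = 2) {a b : Fin n} (hab : a < b) :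
    A.betaNbcBase 1 {a, b} ↔ A.nbcBase 1 {a, b} ∧
      (∃ j < a, (A.H j).direction ≠ (A.H b).direction) ∧
      ∃ j < b, (A.H j).direction ≠ (A.H a).direction := by
  have ha : ({a, b} : Finset (Fin n)).erase a = {b} :=
    Finset.erase_insert (by simpa using hab.ne)
  have hb : ({a, b} : Finset (Fin n)).erase b = {a} := by
    rw [Finset.pair_comm, Finset.erase_insert (by simpa using hab.ne')]
  simp [betaNbcBase, ha, hb, A.isBase_pair_iff hr]

end HArr

open scoped Classical
/-- If `𝒜` has rank 2 and the linear order on `𝒜` is admissible (the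
hyperplanes parallel to `H_1`, including `H_1` itself, are exactly `H_1, …, H_{ν−1}`),
then `βnbc(𝒜) = {(H_{i_1}, H_{i_2}) ∈ nbc : 1 < i_1 < i_2 ≠ ν}`. -/
theorem rank_two_admissible_betaNbc {W : Type} [AddCommGroup W] [Module ℂ W]
    [FiniteDimensional ℂ W] {n : ℕ} (A : HArr W n) (hn : 0 < n)
    (hr : A.rank = 2) (ν : ℕ)
    (hadm : ∀ i : Fin n,
      (A.H i ⊓ A.H ⟨0, hn⟩ = ⊥ ∨ i = ⟨0, hn⟩) ↔ (i : ℕ) + 1 < ν) :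
    ∀ S : Finset (Fin n), A.betaNbcBase 1 S ↔
      (A.nbcBase 1 S ∧ (∀ i ∈ S, 0 < (i : ℕ)) ∧
        ∀ i ∈ S, (∀ j ∈ S, j ≤ i) → (i : ℕ) + 1 ≠ ν) := by
  have hpar : ∀ i : Fin n,
      (A.H i).direction = (A.H ⟨0, hn⟩).direction ↔ (i : ℕ) + 1 < ν := fun i => by
    rw [← hadm i, ← not_iff_not, ← ne_eq, ← A.ne_and_inf_ne_bot_iff]
    tauto
  intro S
  by_cases hS : A.nbcBase 1 S
  swap
  · exact ⟨fun h => absurd h.1 hS, fun h => absurd h.1 hS⟩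
  obtain ⟨a, b, hab, rfl⟩ := A.exists_lt_of_isBase hr hS.2
  have hd := (A.isBase_pair_iff hr).mp hS.2
  have hablt : (a : ℕ) < b := hab
  rw [A.betaNbcBase_pair_iff hr hab]
  refine and_congr_right fun _ => ⟨?_, ?_⟩
  · rintro ⟨⟨j, hja, -⟩, k, hkb, hk⟩
    have hja' : (j : ℕ) < a := hja
    have hkb' : (k : ℕ) < b := hkb
    refine ⟨fun i hi => ?_, fun i _ hmax hν => hk ?_⟩
    · rcases Finset.mem_insert.mp hi with rfl | hi
      · omega
      · rw [Finset.mem_singleton.mp hi]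
        omega
    · have hbi : (b : ℕ) ≤ i := hmax b (by simp)
      have hk0 := (hpar k).mpr (by omega)
      have ha0 := (hpar a).mpr (by omega)
      exact hk0.trans ha0.symm
  · rintro ⟨hpos, hmax⟩
    have ha : 0 < (a : ℕ) := hpos a (by simp)
    have hb : (b : ℕ) + 1 ≠ ν := hmax b (by simp) (by simp [hab.le])
    refine ⟨⟨⟨0, hn⟩, ha, fun h0 => hd ?_⟩, ?_⟩
    · have := (hpar b).mp h0.symm
      exact ((hpar a).mpr (by omega)).trans h0
    · by_cases ha0 : (A.H a).direction = (A.H ⟨0, hn⟩).direction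
      · have haν := (hpar a).mp ha0
        have hbν : ¬ (b : ℕ) + 1 < ν := fun h => hd (ha0.trans ((hpar b).mpr h).symm)
        refine ⟨⟨ν - 1, by omega⟩, ?_, fun h => ?_⟩
        · rw [Fin.lt_def]
          simp only
          omega
        · have := (hpar _).mp (h.trans ha0)
          simp only at this
          omega
      · exact ⟨⟨0, hn⟩, by rw [Fin.lt_def]; simp only; omega, fun h => ha0 h.symm⟩
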